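/- Let n ≥ 1, let 0 < ε < 1/5, and let x, y be n×n complex matrices (with the operator norm from ℓ²_n) such that ‖y x − 1‖ < ε, ‖x‖ < 1 + ε, and ‖y‖ < 1 + ε. Then ‖x y − 1‖ ≤ ε (1 + ε)²/(1 − ε) ≤ ε + 4 ε². -/

import Mathlib

open ContinuousLinearMap

/-- If `‖y * x - 1‖ ≤ ε < 1` and `x` is invertible with inverse `z`, then `‖z‖ ≤ ‖y‖ / (1 - ε)`. -/
theorem norm_inverse_le_of_norm_mul_sub_one_le {R : Type*} [NormedRing R] {x y z : R} {ε : ℝ}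
    (hxz : x * z = 1) (hyx : ‖y * x - 1‖ ≤ ε) (hε : ε < 1) : ‖z‖ ≤ ‖y‖ / (1 - ε) := by
  rw [le_div_iff₀ (sub_pos.2 hε)]
  have hz : z = y - (y * x - 1) * z := by rw [sub_mul, mul_assoc, hxz]; noncomm_ring
  have h₁ : ‖z‖ ≤ ‖y‖ + ‖(y * x - 1) * z‖ := by
    conv_lhs => rw [hz]
    exact norm_sub_le _ _
  have h₂ : ‖(y * x - 1) * z‖ ≤ ε * ‖z‖ := (norm_mul_le _ _).trans (by gcongr)
  linarith

/-- In a complete normed ring where one-sided inverses are two-sided, if `y * x` is close to `1`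
then so is its conjugate `x * y`. -/
theorem norm_mul_sub_one_le_of_norm_mul_sub_one_le {R : Type*} [NormedRing R] [CompleteSpace R]
    [IsDedekindFiniteMonoid R] {x y : R} {ε : ℝ} (hyx : ‖y * x - 1‖ ≤ ε) (hε : ε < 1) :
    ‖x * y - 1‖ ≤ ‖x‖ * ε * (‖y‖ / (1 - ε)) := by
  have hu : IsUnit (y * x) := by
    have h := isUnit_one_sub_of_norm_lt_one (x := 1 - y * x)
      (by rw [norm_sub_rev]; exact hyx.trans_lt hε)
    rwa [sub_sub_cancel] at h
  obtain ⟨z, hzx⟩ : ∃ z, z * x = 1 := by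
    obtain ⟨u, hu⟩ := hu.exists_left_inv
    exact ⟨u * y, by rw [mul_assoc, hu]⟩
  have hxz : x * z = 1 := mul_eq_one_symm hzx
  have hconj : x * y - 1 = x * (y * x - 1) * z := by
    rw [mul_sub, sub_mul, mul_one, hxz, mul_assoc, mul_assoc y, hxz, mul_one]
  rw [hconj]
  refine (norm_mul_le _ _).trans ?_
  gcongr
  · exact mul_nonneg (norm_nonneg _) ((norm_nonneg _).trans hyx)
  · exact (norm_mul_le _ _).trans (by gcongr)
  · exact norm_inverse_le_of_norm_mul_sub_one_le hxz hyx hε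

/-- Claim (8.1) of Example 8.3: if `0 < ε < 1/5`, `‖y x - 1‖ < ε`, `‖x‖ < 1 + ε` and
`‖y‖ < 1 + ε` (operator norms from `ℓ²ₙ`), then
`‖x y - 1‖ ≤ ε (1 + ε)² / (1 - ε) ≤ ε + 4 ε²`. -/
theorem stmt_8 (n : ℕ) (hn : 1 ≤ n) (ε : ℝ) (hε0 : 0 < ε) (hε1 : ε < 1 / 5)
    (x y : Matrix (Fin n) (Fin n) ℂ)
    (hyx : ‖Matrix.toEuclideanCLM (𝕜 := ℂ) (n := Fin n) (y * x - 1)‖ < ε)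
    (hx : ‖Matrix.toEuclideanCLM (𝕜 := ℂ) (n := Fin n) x‖ < 1 + ε)
    (hy : ‖Matrix.toEuclideanCLM (𝕜 := ℂ) (n := Fin n) y‖ < 1 + ε) :
    ‖Matrix.toEuclideanCLM (𝕜 := ℂ) (n := Fin n) (x * y - 1)‖ ≤
        ε * (1 + ε) ^ 2 / (1 - ε) ∧
      ε * (1 + ε) ^ 2 / (1 - ε) ≤ ε + 4 * ε ^ 2 := by
  have hε : 0 < 1 - ε := by linarith
  constructor
  · open scoped Matrix.Norms.L2Operator in
    rw [← Matrix.cstar_norm_def] at hyx hx hy ⊢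
    calc ‖x * y - 1‖ ≤ ‖x‖ * ε * (‖y‖ / (1 - ε)) :=
          norm_mul_sub_one_le_of_norm_mul_sub_one_le hyx.le (by linarith)
      _ ≤ (1 + ε) * ε * ((1 + ε) / (1 - ε)) := by gcongr
      _ = ε * (1 + ε) ^ 2 / (1 - ε) := by ring
  · rw [div_le_iff₀ hε]
    nlinarith [mul_pos (mul_pos hε0 hε0) (sub_pos.2 hε1)]
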